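/- Let T ≥ 1, B ≥ 0, V > 0, θ > 0, and C be real constants with B + V·C ≥ 0. Let Q : ℕ → ℝ with Q(0) = 0 and Q(t) ≥ 0 for all t, and L : ℕ → ℝ with L(t) ≥ 0 for all t. Suppose that for every frame index k, (1/2)·Q((k+1)T)² − (1/2)·Q(kT)² + V·∑_{τ=kT}^{(k+1)T−1} L(τ) ≤ B·T + V·T·C − θ·∑_{τ=kT}^{(k+1)T−1} Q(τ). Then both limsup_{K→∞} (1/(KT))·∑_{t=0}^{KT−1} L(t) ≤ C + B/V and limsup_{K→∞} (1/(KT))·∑_{t=0}^{KT−1} Q(t) ≤ (B + V·C)/θ hold. -/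

import Mathlib

open Filter

/-- **Theorem: performance guarantee of the PSP algorithm.** If the
per-frame drift-plus-penalty bound holds for every frame, then the long-term
average user-perceived latency is at most `C + B/V` and the long-term average
queue backlog is at most `(B + V·C)/θ`. -/
theorem PSP_performance_guarantee
    (T : ℕ) (hT : 1 ≤ T)
    (B V θ C : ℝ) (hB : 0 ≤ B) (hV : 0 < V) (hθ : 0 < θ)
    (hBVC : 0 ≤ B + V * C)
    (Q L : ℕ → ℝ)
    (hQ0 : Q 0 = 0)
    (hQpos : ∀ t, 0 ≤ Q t)
    (hL : ∀ t, 0 ≤ L t)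
    (hdrift : ∀ k : ℕ,
      (1 / 2) * (Q ((k + 1) * T)) ^ 2 - (1 / 2) * (Q (k * T)) ^ 2 +
          V * ∑ τ ∈ Finset.Ico (k * T) ((k + 1) * T), L τ ≤
        B * (T : ℝ) + V * (T : ℝ) * C -
          θ * ∑ τ ∈ Finset.Ico (k * T) ((k + 1) * T), Q τ) :
    (limsup (fun K : ℕ =>
        (1 / ((K : ℝ) * (T : ℝ))) * ∑ t ∈ Finset.range (K * T), L t) atTop ≤
      C + B / V) ∧
    (limsup (fun K : ℕ =>
        (1 / ((K : ℝ) * (T : ℝ))) * ∑ t ∈ Finset.range (K * T), Q t) atTop ≤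
      (B + V * C) / θ) := by
  have key : ∀ K : ℕ, (1 / 2) * (Q (K * T)) ^ 2 +
      V * ∑ t ∈ Finset.range (K * T), L t + θ * ∑ t ∈ Finset.range (K * T), Q t ≤
      (B + V * C) * ((K : ℝ) * (T : ℝ)) := by
    intro K
    induction K with
    | zero => simp [hQ0]
    | succ k ih =>
      have hle : k * T ≤ (k + 1) * T := Nat.mul_le_mul_right T (Nat.le_succ k)
      have h1 := Finset.sum_range_add_sum_Ico L hle
      have h2 := Finset.sum_range_add_sum_Ico Q hle
      have h3 := hdrift k
      rw [← h1, ← h2]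
      push_cast
      linarith
  have hTpos : (0 : ℝ) < T := by exact_mod_cast hT
  have gen : ∀ (f : ℕ → ℝ) (c : ℝ), (∀ t, 0 ≤ f t) →
      (∀ K : ℕ, ∑ t ∈ Finset.range (K * T), f t ≤ c * ((K : ℝ) * (T : ℝ))) →
      limsup (fun K : ℕ =>
        (1 / ((K : ℝ) * (T : ℝ))) * ∑ t ∈ Finset.range (K * T), f t) atTop ≤ c := by
    intro f c hf h
    refine limsup_le_of_le ?_ ?_
    · refine IsCoboundedUnder.of_frequently_ge (a := 0) (Eventually.frequently ?_)
      refine Eventually.of_forall fun K => ?_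
      exact mul_nonneg (by positivity) (Finset.sum_nonneg fun t _ => hf t)
    · filter_upwards [eventually_gt_atTop 0] with K hK
      have hK' : (0 : ℝ) < K := by exact_mod_cast hK
      rw [one_div_mul_eq_div, div_le_iff₀ (by positivity)]
      exact h K
  have sL : ∀ K : ℕ, 0 ≤ ∑ t ∈ Finset.range (K * T), L t :=
    fun K => Finset.sum_nonneg fun t _ => hL t
  have sQ : ∀ K : ℕ, 0 ≤ ∑ t ∈ Finset.range (K * T), Q t :=
    fun K => Finset.sum_nonneg fun t _ => hQpos t
  constructor
  · refine gen L _ hL fun K => ?_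
    have h1 := key K
    have h2 := mul_nonneg hθ.le (sQ K)
    have h3 := sq_nonneg (Q (K * T))
    have h4 : C + B / V = (B + V * C) / V := by field_simp; ring
    rw [h4, div_mul_eq_mul_div, le_div_iff₀ hV]
    linarith
  · refine gen Q _ hQpos fun K => ?_
    have h1 := key K
    have h2 := mul_nonneg hV.le (sL K)
    have h3 := sq_nonneg (Q (K * T))
    rw [div_mul_eq_mul_div, le_div_iff₀ hθ]
    linarith
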